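/- Let A be a complete and cocomplete abelian category, a ∈ ℤ, n ≥ 2, and T_a, …, T_{a+n-1} hereditary torsion classes in A such that the only objects lying in all of them are the zero objects. Let (D^{S,≤0}, D^{S,≥0}) be a t-structure on the unbounded derived category D(A) whose aisle is D^{S,≤0} = { X : H^i(X) ∈ T_j for every a ≤ j ≤ a+n-1 and every i > j }. Then this t-structure is nondegenerate: if an object X lies in D^{S,≤m} for all m ∈ ℤ then X ≅ 0, and if X lies in D^{S,≥m} for all m ∈ ℤ then X ≅ 0. -/

import Mathlib

/-!
STATEMENT 10: Let `A` be a complete and cocomplete abelian category and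
`T_a, …, T_{a+n-1}` (with `n ≥ 2`) hereditary torsion classes whose intersection
consists only of zero objects.  Any t-structure on `D(A)` whose aisle is
`D^{S,≤0} = { X ∈ D(A) : H^i(X) ∈ T_j for all a ≤ j ≤ a+n-1 and all i > j }`
is nondegenerate.
-/

universe w v u

open CategoryTheory CategoryTheory.Limits

/-- A hereditary torsion class in an abelian category: a class of objects containing the
zero objects, closed under isomorphisms, subobjects, quotient objects, extensions and
arbitrary coproducts. -/
def IsHereditaryTorsionClass {A : Type u} [Category.{v} A] [Abelian A]
    [HasColimits A] (T : A → Prop) : Prop :=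
  (∀ X : A, IsZero X → T X) ∧
  (∀ (X Y : A), (X ≅ Y) → T X → T Y) ∧
  (∀ (X Y : A) (f : X ⟶ Y), Mono f → T Y → T X) ∧
  (∀ (X Y : A) (f : X ⟶ Y), Epi f → T X → T Y) ∧
  (∀ S : ShortComplex A, S.ShortExact → T S.X₁ → T S.X₃ → T S.X₂) ∧
  (∀ (ι : Type v) (f : ι → A), (∀ i, T (f i)) → T (∐ f))

namespace DerivedCategory

variable {C : Type u} [Category.{v} C] [Abelian C] [HasDerivedCategory.{w} C]

/-- An object of the derived category with vanishing cohomology is zero. -/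
lemma isZero_of_isZero_homology (X : DerivedCategory C)
    (hX : ∀ i : ℤ, IsZero ((homologyFunctor C i).obj X)) : IsZero X := by
  have : IsIso (0 : X ⟶ X) := (isIso_iff C _).2 fun i => (hX i).isIso (hX i) _
  rw [IsZero.iff_id_eq_zero, ← cancel_mono (0 : X ⟶ X), comp_zero, comp_zero]

/-- The isomorphism `H^i(X⟦m⟧) ≅ H^k(X)` when `m + i = k`. -/
noncomputable def homologyShiftIso (X : DerivedCategory C) (m i k : ℤ) (h : m + i = k) :
    (homologyFunctor C i).obj (X⟦m⟧) ≅ (homologyFunctor C k).obj X :=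
  ((homologyFunctor C 0).shiftIso m i k h).app X

/-- If every morphism to `X` from an object that is bounded above for the canonical t-structure
vanishes, then `X` is zero. -/
lemma isZero_of_forall_isLE_hom_eq_zero (X : DerivedCategory C)
    (hX : ∀ (k : ℤ) (Y : DerivedCategory C), Y.IsLE k → ∀ f : Y ⟶ X, f = 0) : IsZero X := by
  refine isZero_of_isZero_homology X fun k => ?_
  obtain ⟨Y, Z, hY, hZ, f, g, h, hT⟩ := TStructure.t.exists_triangle X k (k + 1) rfl
  have hf : f = 0 := hX k Y ⟨hY⟩ f
  have : Z.IsGE (k + 1) := ⟨hZ⟩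
  have hg : (homologyFunctor C k).map g = 0 :=
    (isZero_of_isGE Z (k + 1) k (by lia)).eq_of_tgt _ _
  have : Epi ((homologyFunctor C k).map f) :=
    (HomologySequence.epi_homologyMap_mor₁_iff _ hT k).2 hg
  exact IsZero.of_epi_eq_zero ((homologyFunctor C k).map f) (by rw [hf, Functor.map_zero])

end DerivedCategory

theorem stmt10 {A : Type u} [Category.{v} A] [Abelian A]
    [HasLimits A] [HasColimits A] [HasDerivedCategory.{w} A]
    (a : ℤ) (n : ℕ) (hn : 2 ≤ n)
    (T : ℤ → A → Prop)
    (hT : ∀ j : ℤ, a ≤ j → j ≤ a + n - 1 → IsHereditaryTorsionClass (T j))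
    (hinter : ∀ X : A, (∀ j : ℤ, a ≤ j → j ≤ a + n - 1 → T j X) → IsZero X)
    (t : Triangulated.TStructure (DerivedCategory A))
    (haisle : ∀ X : DerivedCategory A,
      t.le 0 X ↔ ∀ j i : ℤ, a ≤ j → j ≤ a + n - 1 → j < i →
        T j ((DerivedCategory.homologyFunctor A i).obj X)) :
    (∀ X : DerivedCategory A, (∀ m : ℤ, t.le m X) → IsZero X) ∧
    (∀ X : DerivedCategory A, (∀ m : ℤ, t.ge m X) → IsZero X) := by
  have mem_le (m : ℤ) (X : DerivedCategory A) : t.le m X ↔ t.le 0 (X⟦m⟧) := by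
    rw [← t.shift_le m 0 m (add_zero m), ObjectProperty.prop_shift_iff]
  refine ⟨fun X hX => ?_, fun X hX => ?_⟩
  · refine DerivedCategory.isZero_of_isZero_homology X fun k => hinter _ fun j hj hj' => ?_
    exact (hT j hj hj').2.1 _ _
      (DerivedCategory.homologyShiftIso X (k - (j + 1)) (j + 1) k (by lia))
      ((haisle _).1 ((mem_le _ X).1 (hX _)) j (j + 1) hj hj' (by lia))
  · refine DerivedCategory.isZero_of_forall_isLE_hom_eq_zero X fun k Y hY f => ?_
    have hY' : t.le (k - a) Y := by
      rw [mem_le, haisle]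
      intro j i hj hj' hi
      exact (hT j hj hj').1 _ ((Y.isZero_of_isLE k (k - a + i) (by lia)).of_iso
        (DerivedCategory.homologyShiftIso Y (k - a) i _ rfl))
    exact t.zero_of_isLE_of_isGE f (k - a) (k - a + 1) (by lia) ⟨hY'⟩ ⟨hX _⟩
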